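/- arXiv:nlin/0503059 — 2 statements merged into one kernel-verified Lean document; each statement's English description precedes it below -/
import Mathlib

section
/- Let s ≥ 2, R > 0, H₀, m₀ be real numbers and a > 0, and define F(z) = a + 2m₀·z + s·H₀·z² + (s·R/3)·z³. Assume either (i) m₀ < 0, or (ii) m₀ > 0 and H₀ < −√(2R·m₀/s); let z₀ = (−H₀ + √(H₀² − 2R·m₀/s))/R and assume F(z₀) < 0. Then for every Z ≥ z₀ there is no twice differentiable function f : ℝ → ℝ satisfying f(0) = a, f'(0) = 2m₀, f(z) ≥ 0 for all z ∈ [0, Z], and f''(z) ≤ 2s·(H₀ + Rz) for all z ∈ [0, Z]. -/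
/-- A twice differentiable function whose second derivative is nonpositive on `[0, b]` and whose
derivative vanishes at `0` does not exceed its initial value at `b`. -/
theorem le_of_second_deriv_nonpos {g g' g'' : ℝ → ℝ} {b : ℝ} (hb : 0 ≤ b)
    (hg : ∀ z, HasDerivAt g (g' z) z) (hg' : ∀ z, HasDerivAt g' (g'' z) z)
    (h0 : g' 0 = 0) (hle : ∀ z ∈ Set.Icc (0 : ℝ) b, g'' z ≤ 0) : g b ≤ g 0 := by
  have hanti' : AntitoneOn g' (Set.Icc 0 b) := by
    refine antitoneOn_of_deriv_nonpos (convex_Icc 0 b)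
      (fun z _ => (hg' z).continuousAt.continuousWithinAt)
      (fun z _ => (hg' z).differentiableAt.differentiableWithinAt) fun z hz => ?_
    rw [(hg' z).deriv]
    exact hle z (interior_subset hz)
  have hanti : AntitoneOn g (Set.Icc 0 b) := by
    refine antitoneOn_of_deriv_nonpos (convex_Icc 0 b)
      (fun z _ => (hg z).continuousAt.continuousWithinAt)
      (fun z _ => (hg z).differentiableAt.differentiableWithinAt) fun z hz => ?_
    have hz' : z ∈ Set.Icc 0 b := interior_subset hz
    rw [(hg z).deriv, ← h0]
    exact hanti' (Set.left_mem_Icc.2 hb) hz' hz'.1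
  exact hanti (Set.left_mem_Icc.2 hb) (Set.right_mem_Icc.2 hb) hb


/-- Proposition 3 (finite-time singularity) in ODE form: under condition
(i) `m₀ < 0` or condition (ii) `m₀ > 0` and `H₀ < −√(2R·m₀/s)`, if the
bounding cubic `F(z) = a + 2m₀z + sH₀z² + (sR/3)z³` is strictly negative
at its critical point `z₀`, then for every `Z ≥ z₀` no twice differentiable
nonnegative-on-`[0,Z]` function `f` with `f 0 = a`, `f' 0 = 2m₀` and
`f'' z ≤ 2s(H₀ + Rz)` on `[0,Z]` can exist. -/
theorem stmt_6 (s R H₀ a m₀ : ℝ) (hs : 2 ≤ s) (hR : 0 < R) (ha : 0 < a)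
    (F : ℝ → ℝ)
    (hF : ∀ z : ℝ, F z = a + 2 * m₀ * z + s * H₀ * z ^ 2 + (s * R / 3) * z ^ 3)
    (hcond : m₀ < 0 ∨ (0 < m₀ ∧ H₀ < -Real.sqrt (2 * R * m₀ / s)))
    (z₀ : ℝ) (hz₀ : z₀ = (-H₀ + Real.sqrt (H₀ ^ 2 - 2 * R * m₀ / s)) / R)
    (hFz₀ : F z₀ < 0) :
    ∀ Z : ℝ, z₀ ≤ Z →
      ¬ ∃ f : ℝ → ℝ, Differentiable ℝ f ∧ Differentiable ℝ (deriv f) ∧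
        f 0 = a ∧ deriv f 0 = 2 * m₀ ∧
        (∀ z ∈ Set.Icc (0 : ℝ) Z, 0 ≤ f z) ∧
        (∀ z ∈ Set.Icc (0 : ℝ) Z, deriv (deriv f) z ≤ 2 * s * (H₀ + R * z)) := by
  rintro Z hZ ⟨f, hf, hf', hf0, hf'0, hnonneg, hle⟩
  have hz₀_nonneg : 0 ≤ z₀ := by
    rw [hz₀]
    refine div_nonneg ?_ hR.le
    rcases hcond with hm | ⟨-, hH⟩
    · have hneg : 2 * R * m₀ / s ≤ 0 :=
        div_nonpos_of_nonpos_of_nonneg (by nlinarith) (by linarith)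
      have := Real.abs_le_sqrt (show H₀ ^ 2 ≤ H₀ ^ 2 - 2 * R * m₀ / s by linarith)
      linarith [le_abs_self H₀]
    · linarith [Real.sqrt_nonneg (2 * R * m₀ / s),
        Real.sqrt_nonneg (H₀ ^ 2 - 2 * R * m₀ / s)]
  have hFd (z : ℝ) : HasDerivAt F (2 * m₀ + 2 * s * H₀ * z + s * R * z ^ 2) z := by
    rw [funext hF]
    have h := ((((hasDerivAt_id' z).const_mul (2 * m₀)).const_add a).add
      ((hasDerivAt_pow 2 z).const_mul (s * H₀))).add
      ((hasDerivAt_pow 3 z).const_mul (s * R / 3))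
    refine h.congr_deriv ?_
    norm_num
    ring
  have hFdd (z : ℝ) : HasDerivAt (fun z => 2 * m₀ + 2 * s * H₀ * z + s * R * z ^ 2)
      (2 * s * (H₀ + R * z)) z := by
    have h := (((hasDerivAt_id' z).const_mul (2 * s * H₀)).const_add (2 * m₀)).add
      ((hasDerivAt_pow 2 z).const_mul (s * R))
    refine h.congr_deriv ?_
    norm_num
    ring
  have hcomp := le_of_second_deriv_nonpos hz₀_nonneg
    (fun z => (hf z).hasDerivAt.sub (hFd z)) (fun z => (hf' z).hasDerivAt.sub (hFdd z))
    (by simp [hf'0]) (fun z hz => sub_nonpos.2 (hle z ⟨hz.1, hz.2.trans hZ⟩))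
  have hF0 : F 0 = a := by simp [hF]
  simp only [Pi.sub_apply, hf0, hF0] at hcomp
  linarith [hnonneg z₀ ⟨hz₀_nonneg, hZ⟩]
end

section
/- Let s > 2 and T > 0 be real numbers, and let x, m, p : ℝ → ℝ be functions such that x(0) > 0, m(0) < 0, and for every z ∈ [0, T): x is differentiable at z with x'(z) = 2·m(z); m is differentiable at z with m'(z) ≤ ((2 − s)/2)·p(z); p(z) ≥ 0; and m(z)² ≤ x(z)·p(z). Then T ≤ 2·x(0)/((s − 2)·(−m(0))). -/
/-- Proposition 5 (blow-up in the supercritical focusing case) in ODE form: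
if `x 0 > 0`, `m 0 < 0`, and on `[0, T)` we have `x' = 2m`,
`m' ≤ ((2−s)/2)·p`, `p ≥ 0` and the Cauchy–Schwarz bound `m² ≤ x·p`,
then `T ≤ 2·x 0/((s−2)·(−m 0))`. -/
theorem stmt_9 (s T : ℝ) (hs : 2 < s) (hT : 0 < T)
    (x m p : ℝ → ℝ)
    (hx0 : 0 < x 0) (hm0 : m 0 < 0)
    (hx : ∀ z ∈ Set.Ico (0 : ℝ) T, HasDerivAt x (2 * m z) z)
    (hmdiff : ∀ z ∈ Set.Ico (0 : ℝ) T, DifferentiableAt ℝ m z)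
    (hm : ∀ z ∈ Set.Ico (0 : ℝ) T, deriv m z ≤ (2 - s) / 2 * p z)
    (hp : ∀ z ∈ Set.Ico (0 : ℝ) T, 0 ≤ p z)
    (hcs : ∀ z ∈ Set.Ico (0 : ℝ) T, (m z) ^ 2 ≤ x z * p z) :
    T ≤ 2 * x 0 / ((s - 2) * (-(m 0))) := by
  have hm_anti : AntitoneOn m (Set.Ico 0 T) := by
    refine antitoneOn_of_deriv_nonpos (convex_Ico 0 T)
      (fun z hz => (hmdiff z hz).continuousAt.continuousWithinAt)
      (fun z hz => (hmdiff z (interior_subset hz)).differentiableWithinAt) fun z hz => ?_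
    have hz := interior_subset hz
    nlinarith [hm z hz, hp z hz]
  have hm_neg : ∀ z ∈ Set.Ico (0 : ℝ) T, m z < 0 := fun z hz =>
    (hm_anti ⟨le_rfl, hT⟩ hz hz.1).trans_lt hm0
  have hx_pos : ∀ z ∈ Set.Ico (0 : ℝ) T, 0 < x z := fun z hz =>
    pos_of_mul_pos_left ((sq_pos_of_neg (hm_neg z hz)).trans_le (hcs z hz)) (hp z hz)
  have hderiv : ∀ z ∈ Set.Ico (0 : ℝ) T,
      HasDerivAt (fun y => x y / m y - (s - 2) / 2 * y)
        ((2 * m z * m z - x z * deriv m z) / m z ^ 2 - (s - 2) / 2 * 1) z := fun z hz =>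
    ((hx z hz).div (hmdiff z hz).hasDerivAt (hm_neg z hz).ne).sub
      ((hasDerivAt_id z).const_mul _)
  have hmono : MonotoneOn (fun y => x y / m y - (s - 2) / 2 * y) (Set.Ico 0 T) := by
    refine monotoneOn_of_deriv_nonneg (convex_Ico 0 T)
      (fun z hz => (hderiv z hz).continuousAt.continuousWithinAt)
      (fun z hz => (hderiv z (interior_subset hz)).differentiableAt.differentiableWithinAt)
      fun z hz => ?_
    have hz := interior_subset hz
    rw [(hderiv z hz).deriv, sub_nonneg, le_div_iff₀ (sq_pos_of_neg (hm_neg z hz))]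
    have h1 := mul_le_mul_of_nonneg_left (hm z hz) (hx_pos z hz).le
    have h2 := mul_le_mul_of_nonneg_left (hcs z hz) (by linarith : 0 ≤ (s - 2) / 2)
    nlinarith [sq_nonneg (m z)]
  refine le_of_forall_lt_imp_le_of_dense fun z hzT => ?_
  have hden : 0 < (s - 2) * (-(m 0)) := mul_pos (by linarith) (by linarith)
  rcases lt_or_ge z 0 with hz0 | hz0
  · exact hz0.le.trans (by positivity)
  have hle := hmono ⟨le_rfl, hT⟩ ⟨hz0, hzT⟩ hz0
  have hneg : x z / m z < 0 := div_neg_of_pos_of_neg (hx_pos z ⟨hz0, hzT⟩) (hm_neg z ⟨hz0, hzT⟩)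
  have hbound : -(x 0) / (-(m 0)) ≤ -((s - 2) / 2 * z) := by
    rw [neg_div_neg_eq]
    simp only [mul_zero, sub_zero] at hle
    linarith
  rw [div_le_iff₀ (by linarith)] at hbound
  rw [le_div_iff₀ hden]
  linarith
end
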